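/- Let δ ∈ ℝ and let S^{ab} = S^{ba}, P^a, Q^a, c₀, c₁, c₂ be smooth real functions on ℝⁿ. For λ ∈ ℝ define the quadratic pencil Δ_λ f = (1/2)(S^{ab}∂_a∂_b f + (P^a + λQ^a)∂_a f + (c₀ + λc₁ + λ²c₂)f) on smooth functions. Then the pencil satisfies the normalization Δ₀(1) = 0 and the self-adjointness condition ∫_{ℝⁿ}(Δ_λ f)·g dx = ∫_{ℝⁿ} f·(Δ_{1−λ−δ} g) dx for every λ ∈ ℝ and all compactly supported smooth f, g, if and only if c₀ = 0, P^a = ∂_b S^{ba} + (δ−1)(Q^a/2), and c₁ = ∂_a(Q^a/2) + (δ−1)c₂; that is, if and only if Δ_λ is the canonical pencil Δ_λ f = (1/2)(S^{ab}∂_a∂_b f + (∂_b S^{ba})∂_a f + (2λ+δ−1)γ^a∂_a f + λ(∂_aγ^a)f + λ(λ+δ−1)θ f) with γ^a = Q^a/2 and θ = c₂. -/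

import Mathlib

open MeasureTheory Real

/-- Partial derivative of a function on ℝⁿ in the direction of the `a`-th coordinate. -/
noncomputable def pd {n : ℕ} (a : Fin n) (f : (Fin n → ℝ) → ℝ) : (Fin n → ℝ) → ℝ :=
  fun x => fderiv ℝ f x (Pi.single a 1)

/-- The canonical pencil operator of weight `δ` with data `(S, γ, θ)`. -/
noncomputable def pencil {n : ℕ} (δ lam : ℝ) (S : Fin n → Fin n → (Fin n → ℝ) → ℝ)
    (γ : Fin n → (Fin n → ℝ) → ℝ) (θ : (Fin n → ℝ) → ℝ)
    (f : (Fin n → ℝ) → ℝ) (x : Fin n → ℝ) : ℝ :=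
  (1/2) * (∑ a, ∑ b, S a b x * pd a (pd b f) x
    + ∑ a, (∑ b, pd b (S b a) x) * pd a f x
    + (2*lam + δ - 1) * ∑ a, γ a x * pd a f x
    + lam * (∑ a, pd a (γ a) x) * f x
    + lam * (lam + δ - 1) * θ x * f x)

/-- A quadratic pencil `Δ_λ f = (1/2)(S^{ab}∂_a∂_b f + (P^a + λQ^a)∂_a f
  + (c₀ + λc₁ + λ²c₂)f)`. -/
noncomputable def quadPencil {n : ℕ} (lam : ℝ) (S : Fin n → Fin n → (Fin n → ℝ) → ℝ)
    (P Q : Fin n → (Fin n → ℝ) → ℝ) (c₀ c₁ c₂ : (Fin n → ℝ) → ℝ)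
    (f : (Fin n → ℝ) → ℝ) (x : Fin n → ℝ) : ℝ :=
  (1/2) * (∑ a, ∑ b, S a b x * pd a (pd b f) x
    + ∑ a, (P a x + lam * Q a x) * pd a f x
    + (c₀ x + lam * c₁ x + lam^2 * c₂ x) * f x)

/-- A smooth compactly supported real function on ℝⁿ. -/
def IsTest {n : ℕ} (f : (Fin n → ℝ) → ℝ) : Prop :=
  ContDiff ℝ (⊤ : ℕ∞) f ∧ HasCompactSupport f

/-- `T` and `T'` preserve test functions and are adjoint for the `L²` pairing on them. -/
structure FormalAdjoint {n : ℕ} (T T' : ((Fin n → ℝ) → ℝ) → ((Fin n → ℝ) → ℝ)) : Prop where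
  left : ∀ f, IsTest f → IsTest (T f)
  right : ∀ f, IsTest f → IsTest (T' f)
  integral_eq : ∀ f g, IsTest f → IsTest g → ∫ x, T f x * g x = ∫ x, f x * T' g x

/-- The second-order differential operator with coefficients `S`, `A`, `C`. -/
noncomputable def diffOp {n : ℕ} (S : Fin n → Fin n → (Fin n → ℝ) → ℝ)
    (A : Fin n → (Fin n → ℝ) → ℝ) (C : (Fin n → ℝ) → ℝ)
    (f : (Fin n → ℝ) → ℝ) (x : Fin n → ℝ) : ℝ :=
  ∑ a, ∑ b, S a b x * pd a (pd b f) x + ∑ a, A a x * pd a f x + C x * f x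

/-- The divergence `∂_b S^{ba}` of a matrix of functions. -/
noncomputable def matDiv {n : ℕ} (S : Fin n → Fin n → (Fin n → ℝ) → ℝ) (a : Fin n)
    (x : Fin n → ℝ) : ℝ := ∑ b, pd b (S b a) x

section PartialDerivative

variable {n : ℕ} {f g : (Fin n → ℝ) → ℝ}

theorem contDiff_pd (a : Fin n) (hf : ContDiff ℝ (⊤ : ℕ∞) f) :
    ContDiff ℝ (⊤ : ℕ∞) (pd a f) :=
  (hf.fderiv_right (m := (⊤ : ℕ∞)) (by simp)).clm_apply contDiff_const

theorem ContDiff.differentiableAt_of_smooth (hf : ContDiff ℝ (⊤ : ℕ∞) f) (x : Fin n → ℝ) :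
    DifferentiableAt ℝ f x :=
  (hf.differentiable (by simp)) x

theorem pd_mul (a : Fin n) (hf : ContDiff ℝ (⊤ : ℕ∞) f) (hg : ContDiff ℝ (⊤ : ℕ∞) g)
    (x : Fin n → ℝ) :
    pd a (fun y => f y * g y) x = pd a f x * g x + f x * pd a g x := by
  unfold pd
  rw [fderiv_fun_mul (hf.differentiableAt_of_smooth x) (hg.differentiableAt_of_smooth x)]
  simp
  ring

theorem pd_add (a : Fin n) (hf : ContDiff ℝ (⊤ : ℕ∞) f) (hg : ContDiff ℝ (⊤ : ℕ∞) g)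
    (x : Fin n → ℝ) :
    pd a (fun y => f y + g y) x = pd a f x + pd a g x := by
  unfold pd
  rw [fderiv_fun_add (hf.differentiableAt_of_smooth x) (hg.differentiableAt_of_smooth x)]
  simp

theorem pd_const_mul (a : Fin n) (c : ℝ) (hf : ContDiff ℝ (⊤ : ℕ∞) f) (x : Fin n → ℝ) :
    pd a (fun y => c * f y) x = c * pd a f x := by
  unfold pd
  rw [fderiv_const_mul (hf.differentiableAt_of_smooth x)]
  simp

theorem pd_sum {ι : Type*} (s : Finset ι) (a : Fin n) {F : ι → (Fin n → ℝ) → ℝ}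
    (hF : ∀ i, ContDiff ℝ (⊤ : ℕ∞) (F i)) (x : Fin n → ℝ) :
    pd a (fun y => ∑ i ∈ s, F i y) x = ∑ i ∈ s, pd a (F i) x := by
  unfold pd
  rw [fderiv_fun_sum fun i _ => (hF i).differentiableAt_of_smooth x]
  simp

theorem pd_const (a : Fin n) (c : ℝ) : pd a (fun _ => c) = fun _ => 0 := by
  funext x
  simp [pd]

theorem pd_coord_sub (a b : Fin n) (c : ℝ) :
    pd b (fun x => x a - c) = fun _ => if a = b then 1 else 0 := by
  funext x
  unfold pd
  rw [fderiv_sub_const, (hasFDerivAt_apply a x).fderiv]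
  simp [Pi.single_apply]

theorem Filter.EventuallyEq.pd {x : Fin n → ℝ} (h : f =ᶠ[nhds x] g) (a : Fin n) :
    pd a f =ᶠ[nhds x] pd a g :=
  (h.fderiv (𝕜 := ℝ)).mono fun y hy => by simp only [_root_.pd, hy]

end PartialDerivative

section FormalAdjoint

variable {n : ℕ}

theorem IsTest.integrable {f : (Fin n → ℝ) → ℝ} (hf : IsTest f) : Integrable f :=
  hf.1.continuous.integrable_of_hasCompactSupport hf.2

theorem IsTest.mul_left {f g : (Fin n → ℝ) → ℝ} (hg : IsTest g) (hf : ContDiff ℝ (⊤ : ℕ∞) f) :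
    IsTest (fun x => f x * g x) :=
  ⟨hf.mul hg.1, hg.2.mul_left⟩

theorem IsTest.pd {f : (Fin n → ℝ) → ℝ} (hf : IsTest f) (a : Fin n) : IsTest (pd a f) :=
  ⟨contDiff_pd a hf.1, hf.2.fderiv_apply (𝕜 := ℝ) _⟩

theorem IsTest.add {f g : (Fin n → ℝ) → ℝ} (hf : IsTest f) (hg : IsTest g) :
    IsTest (fun x => f x + g x) :=
  ⟨hf.1.add hg.1, hf.2.add hg.2⟩

theorem isTest_zero : IsTest (fun _ : Fin n → ℝ => (0 : ℝ)) :=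
  ⟨contDiff_const, HasCompactSupport.zero⟩

namespace FormalAdjoint

variable {T T' U U' : ((Fin n → ℝ) → ℝ) → ((Fin n → ℝ) → ℝ)}

theorem mul {h : (Fin n → ℝ) → ℝ} (hh : ContDiff ℝ (⊤ : ℕ∞) h) :
    FormalAdjoint (fun f x => h x * f x) (fun f x => h x * f x) where
  left _ hf := hf.mul_left hh
  right _ hf := hf.mul_left hh
  integral_eq f g _ _ := by
    congr 1
    funext x
    ring

theorem pd (a : Fin n) : FormalAdjoint (pd a) (fun f x => (-1) * pd a f x) where
  left _ hf := hf.pd a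
  right _ hf := (hf.pd a).mul_left contDiff_const
  integral_eq f g hf hg := by
    have h := integral_mul_fderiv_eq_neg_fderiv_mul_of_integrable (μ := (volume : Measure (Fin n → ℝ)))
      (f := f) (g := g) (v := Pi.single a 1)
      (hg.mul_left (hf.pd a).1).integrable ((hg.pd a).mul_left hf.1).integrable
      (hg.mul_left hf.1).integrable
      (fun x _ => hf.1.differentiableAt_of_smooth x) (fun x _ => hg.1.differentiableAt_of_smooth x)
    calc ∫ x, _root_.pd a f x * g x = - ∫ x, f x * _root_.pd a g x := by
          unfold _root_.pd
          rw [h, neg_neg]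
      _ = ∫ x, f x * ((-1) * _root_.pd a g x) := by
          rw [← integral_neg]
          congr 1
          funext x
          ring

theorem comp (hT : FormalAdjoint T T') (hU : FormalAdjoint U U') :
    FormalAdjoint (fun f => T (U f)) (fun f => U' (T' f)) where
  left f hf := hT.left _ (hU.left f hf)
  right f hf := hU.right _ (hT.right f hf)
  integral_eq f g hf hg := by
    rw [hT.integral_eq _ _ (hU.left f hf) hg, hU.integral_eq _ _ hf (hT.right g hg)]

theorem add (hT : FormalAdjoint T T') (hU : FormalAdjoint U U') :
    FormalAdjoint (fun f x => T f x + U f x) (fun f x => T' f x + U' f x) where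
  left f hf := (hT.left f hf).add (hU.left f hf)
  right f hf := (hT.right f hf).add (hU.right f hf)
  integral_eq f g hf hg := by
    simp only [add_mul, mul_add]
    rw [integral_add (hg.mul_left (hT.left f hf).1).integrable
        (hg.mul_left (hU.left f hf).1).integrable,
      integral_add ((hT.right g hg).mul_left hf.1).integrable
        ((hU.right g hg).mul_left hf.1).integrable,
      hT.integral_eq f g hf hg, hU.integral_eq f g hf hg]

theorem zero : FormalAdjoint (fun (_ : (Fin n → ℝ) → ℝ) _ => 0) (fun _ _ => 0) where
  left _ _ := isTest_zero
  right _ _ := isTest_zero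
  integral_eq _ _ _ _ := by simp

theorem sum {ι : Type*} (s : Finset ι) {V V' : ι → ((Fin n → ℝ) → ℝ) → ((Fin n → ℝ) → ℝ)}
    (h : ∀ i, FormalAdjoint (V i) (V' i)) :
    FormalAdjoint (fun f x => ∑ i ∈ s, V i f x) (fun f x => ∑ i ∈ s, V' i f x) := by
  classical
  induction s using Finset.induction_on with
  | empty => simpa using zero
  | insert i s hi ih => simpa only [Finset.sum_insert hi] using (h i).add ih

end FormalAdjoint

variable {S : Fin n → Fin n → (Fin n → ℝ) → ℝ} {A : Fin n → (Fin n → ℝ) → ℝ}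
  {C : (Fin n → ℝ) → ℝ}

theorem contDiff_matDiv (hS : ∀ a b, ContDiff ℝ (⊤ : ℕ∞) (S a b)) (a : Fin n) :
    ContDiff ℝ (⊤ : ℕ∞) (matDiv S a) :=
  ContDiff.sum fun b _ => contDiff_pd b (hS b a)

theorem formalAdjoint_diffOp (hS : ∀ a b, ContDiff ℝ (⊤ : ℕ∞) (S a b))
    (hA : ∀ a, ContDiff ℝ (⊤ : ℕ∞) (A a)) (hC : ContDiff ℝ (⊤ : ℕ∞) C) :
    FormalAdjoint (diffOp S A C) (fun g x =>
      ∑ a, ∑ b, (-1) * pd b (fun y => (-1) * pd a (fun z => S a b z * g z) y) x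
        + ∑ a, (-1) * pd a (fun y => A a y * g y) x + C x * g x) :=
  ((FormalAdjoint.sum _ fun a => FormalAdjoint.sum _ fun b =>
      (FormalAdjoint.mul (hS a b)).comp ((FormalAdjoint.pd a).comp (FormalAdjoint.pd b))).add
    (FormalAdjoint.sum _ fun a => (FormalAdjoint.mul (hA a)).comp (FormalAdjoint.pd a))).add
    (FormalAdjoint.mul hC)

theorem adjoint_diffOp_eq (hS : ∀ a b, ContDiff ℝ (⊤ : ℕ∞) (S a b))
    (hSsymm : ∀ a b, S a b = S b a) (hA : ∀ a, ContDiff ℝ (⊤ : ℕ∞) (A a))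
    {g : (Fin n → ℝ) → ℝ} (hg : ContDiff ℝ (⊤ : ℕ∞) g) (x : Fin n → ℝ) :
    ∑ a, ∑ b, (-1) * pd b (fun y => (-1) * pd a (fun z => S a b z * g z) y) x
        + ∑ a, (-1) * pd a (fun y => A a y * g y) x + C x * g x
      = diffOp S (fun a y => 2 * matDiv S a y - A a y)
          (fun y => ∑ a, pd a (matDiv S a) y - ∑ a, pd a (A a) y + C y) g x := by
  have second : ∀ a b, (-1) * pd b (fun y => (-1) * pd a (fun z => S a b z * g z) y) x
      = pd b (pd a (S a b)) x * g x + pd a (S a b) x * pd b g x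
        + pd b (S b a) x * pd a g x + S b a x * pd b (pd a g) x := by
    intro a b
    have hSg : ContDiff ℝ (⊤ : ℕ∞) (fun z => S a b z * g z) := (hS a b).mul hg
    rw [pd_const_mul b _ (contDiff_pd a hSg),
      show pd a (fun z => S a b z * g z) = fun y => pd a (S a b) y * g y + S a b y * pd a g y from
        funext fun y => pd_mul a (hS a b) hg y,
      pd_add b ((contDiff_pd a (hS a b)).mul hg) ((hS a b).mul (contDiff_pd a hg)),
      pd_mul b (contDiff_pd a (hS a b)) hg, pd_mul b (hS a b) (contDiff_pd a hg), hSsymm b a]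
    ring
  have first : ∀ a, (-1) * pd a (fun y => A a y * g y) x
      = - (pd a (A a) x * g x) - A a x * pd a g x := by
    intro a
    rw [pd_mul a (hA a) hg]
    ring
  have hdiv : ∀ a, pd a (matDiv S a) x = ∑ b, pd a (pd b (S b a)) x := fun a =>
    pd_sum _ a (fun b => contDiff_pd b (hS b a)) x
  have e₁ : ∑ a, ∑ b, pd b (pd a (S a b)) x * g x = (∑ a, pd a (matDiv S a) x) * g x := by
    rw [Finset.sum_comm, Finset.sum_mul]
    exact Finset.sum_congr rfl fun a _ => by rw [hdiv, Finset.sum_mul]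
  have e₂ : ∑ a, ∑ b, pd a (S a b) x * pd b g x = ∑ a, matDiv S a x * pd a g x := by
    rw [Finset.sum_comm]
    exact Finset.sum_congr rfl fun a _ => by rw [matDiv, Finset.sum_mul]
  have e₃ : ∑ a, ∑ b, pd b (S b a) x * pd a g x = ∑ a, matDiv S a x * pd a g x :=
    Finset.sum_congr rfl fun a _ => by rw [matDiv, Finset.sum_mul]
  have e₄ : ∑ a, ∑ b, S b a x * pd b (pd a g) x = ∑ a, ∑ b, S a b x * pd a (pd b g) x :=
    Finset.sum_comm
  have e₅ : ∑ a, (2 * matDiv S a x - A a x) * pd a g x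
      = 2 * ∑ a, matDiv S a x * pd a g x - ∑ a, A a x * pd a g x := by
    rw [Finset.mul_sum, ← Finset.sum_sub_distrib]
    exact Finset.sum_congr rfl fun a _ => by ring
  simp only [second, first, diffOp, Finset.sum_add_distrib, Finset.sum_sub_distrib,
    Finset.sum_neg_distrib]
  rw [e₁, e₂, e₃, e₄, e₅, ← Finset.sum_mul]
  ring

theorem integral_diffOp_mul (hS : ∀ a b, ContDiff ℝ (⊤ : ℕ∞) (S a b))
    (hSsymm : ∀ a b, S a b = S b a) (hA : ∀ a, ContDiff ℝ (⊤ : ℕ∞) (A a))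
    (hC : ContDiff ℝ (⊤ : ℕ∞) C) {f g : (Fin n → ℝ) → ℝ} (hf : IsTest f) (hg : IsTest g) :
    ∫ x, diffOp S A C f x * g x
      = ∫ x, f x * diffOp S (fun a y => 2 * matDiv S a y - A a y)
          (fun y => ∑ a, pd a (matDiv S a) y - ∑ a, pd a (A a) y + C y) g x := by
  rw [(formalAdjoint_diffOp hS hA hC).integral_eq f g hf hg]
  simp only [adjoint_diffOp_eq hS hSsymm hA hg.1]

theorem diffOp_congr {f g : (Fin n → ℝ) → ℝ} {x : Fin n → ℝ} (h : f =ᶠ[nhds x] g) :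
    diffOp S A C f x = diffOp S A C g x := by
  simp only [diffOp, h.eq_of_nhds, (h.pd _).eq_of_nhds, ((h.pd _).pd _).eq_of_nhds]

theorem diffOp_one (x : Fin n → ℝ) : diffOp S A C (fun _ => 1) x = C x := by
  simp [diffOp, pd_const]

theorem diffOp_coord_sub (a : Fin n) (x : Fin n → ℝ) :
    diffOp S A C (fun y => y a - x a) x = A a x := by
  simp [diffOp, pd_coord_sub, pd_const]

theorem diffOp_coeff_eq {A' : Fin n → (Fin n → ℝ) → ℝ} {C' : (Fin n → ℝ) → ℝ}
    (hS : ∀ a b, ContDiff ℝ (⊤ : ℕ∞) (S a b))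
    (hA : ∀ a, ContDiff ℝ (⊤ : ℕ∞) (A a)) (hC : ContDiff ℝ (⊤ : ℕ∞) C)
    (hA' : ∀ a, ContDiff ℝ (⊤ : ℕ∞) (A' a)) (hC' : ContDiff ℝ (⊤ : ℕ∞) C')
    (h : ∀ f g, IsTest f → IsTest g →
      ∫ x, f x * diffOp S A C g x = ∫ x, f x * diffOp S A' C' g x) (x : Fin n → ℝ) :
    (∀ a, A a x = A' a x) ∧ C x = C' x := by
  have test : ∀ g, IsTest g → diffOp S A C g = diffOp S A' C' g := by
    intro g hg
    have h₁ := (formalAdjoint_diffOp hS hA hC).left g hg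
    have h₂ := (formalAdjoint_diffOp hS hA' hC').left g hg
    have hcont : Continuous (fun x => diffOp S A C g x - diffOp S A' C' g x) :=
      h₁.1.continuous.sub h₂.1.continuous
    have hae : ∀ᵐ x, diffOp S A C g x - diffOp S A' C' g x = 0 := by
      refine ae_eq_zero_of_integral_contDiff_smul_eq_zero hcont.locallyIntegrable
        fun f hf hf' => ?_
      simp only [smul_eq_mul, mul_sub]
      rw [integral_sub (h₁.mul_left hf).integrable (h₂.mul_left hf).integrable,
        h f g ⟨hf, hf'⟩ hg, sub_self]
    have hzero := (hcont.ae_eq_iff_eq volume continuous_const).1 hae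
    exact funext fun x => sub_eq_zero.1 (congrFun hzero x)
  have smooth : ∀ g, ContDiff ℝ (⊤ : ℕ∞) g → diffOp S A C g x = diffOp S A' C' g x := by
    intro g hg
    let χ : ContDiffBump x := ⟨1, 2, one_pos, one_lt_two⟩
    have hχ : IsTest (fun y => g y * χ y) := IsTest.mul_left ⟨χ.contDiff, χ.hasCompactSupport⟩ hg
    have hloc : (fun y => g y * χ y) =ᶠ[nhds x] g :=
      χ.eventuallyEq_one.mono fun y hy => by simp [hy]
    rw [← diffOp_congr hloc, ← diffOp_congr hloc, test _ hχ]
  refine ⟨fun a => ?_, ?_⟩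
  · simpa only [diffOp_coord_sub] using
      smooth (fun y => y a - x a) ((contDiff_apply ℝ ℝ a).sub contDiff_const)
  · simpa only [diffOp_one] using smooth (fun _ => 1) contDiff_const

end FormalAdjoint

theorem quadPencil_eq_diffOp {n : ℕ} (lam : ℝ) (S : Fin n → Fin n → (Fin n → ℝ) → ℝ)
    (P Q : Fin n → (Fin n → ℝ) → ℝ) (c₀ c₁ c₂ f : (Fin n → ℝ) → ℝ) (x : Fin n → ℝ) :
    quadPencil lam S P Q c₀ c₁ c₂ f x = (1 / 2) * diffOp S (fun a y => P a y + lam * Q a y)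
      (fun y => c₀ y + lam * c₁ y + lam ^ 2 * c₂ y) f x := rfl

theorem pencil_eq_diffOp {n : ℕ} (δ lam : ℝ) (S : Fin n → Fin n → (Fin n → ℝ) → ℝ)
    (γ : Fin n → (Fin n → ℝ) → ℝ) (θ f : (Fin n → ℝ) → ℝ) (x : Fin n → ℝ) :
    pencil δ lam S γ θ f x = (1 / 2) * diffOp S
      (fun a y => matDiv S a y + (2 * lam + δ - 1) * γ a y)
      (fun y => lam * (∑ a, pd a (γ a) y) + lam * (lam + δ - 1) * θ y) f x := by
  simp only [pencil, diffOp, matDiv, add_mul, Finset.sum_add_distrib, Finset.mul_sum, mul_assoc]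
  ring

section Pencil

variable {n : ℕ} {δ : ℝ} {S : Fin n → Fin n → (Fin n → ℝ) → ℝ} {P Q : Fin n → (Fin n → ℝ) → ℝ}
  {c₀ c₁ c₂ : (Fin n → ℝ) → ℝ}

theorem quadPencil_eq_pencil_iff :
    ((∀ x, c₀ x = 0) ∧
      (∀ a x, P a x = matDiv S a x + (δ - 1) * (Q a x / 2)) ∧
      (∀ x, c₁ x = (∑ a, pd a (fun y => Q a y / 2) x) + (δ - 1) * c₂ x))
      ↔ (∀ lam : ℝ, ∀ f : (Fin n → ℝ) → ℝ, ∀ x,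
          quadPencil lam S P Q c₀ c₁ c₂ f x
            = pencil δ lam S (fun a y => Q a y / 2) c₂ f x) := by
  simp only [quadPencil_eq_diffOp, pencil_eq_diffOp]
  constructor
  · rintro ⟨h₀, hP, h₁⟩ lam f x
    simp only [diffOp, h₀, hP, h₁]
    congr 2
    · congr 1
      exact Finset.sum_congr rfl fun a _ => by ring
    · ring
  · intro h
    have hone : ∀ lam x, _ := fun lam x => h lam (fun _ => 1) x
    simp only [diffOp_one] at hone
    have h₀ : ∀ x, c₀ x = 0 := fun x => by linarith [hone 0 x]
    refine ⟨h₀, fun a x => ?_, fun x => ?_⟩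
    · have := h 0 (fun y => y a - x a) x
      simp only [diffOp_coord_sub] at this
      linarith
    · have := hone 1 x
      rw [h₀] at this
      linarith

theorem pd_matDiv_add (hS : ∀ a b, ContDiff ℝ (⊤ : ℕ∞) (S a b))
    (hQ : ∀ a, ContDiff ℝ (⊤ : ℕ∞) (Q a))
    (h : ∀ a x, P a x = matDiv S a x + (δ - 1) * (Q a x / 2)) (lam : ℝ) (x : Fin n → ℝ) :
    ∑ a, pd a (fun y => P a y + lam * Q a y) x
      = ∑ a, pd a (matDiv S a) x + (2 * lam + δ - 1) * ∑ a, pd a (fun y => Q a y / 2) x := by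
  have hQ' : ∀ a, ContDiff ℝ (⊤ : ℕ∞) (fun y => Q a y / 2) := fun a => (hQ a).div_const 2
  rw [Finset.mul_sum, ← Finset.sum_add_distrib]
  refine Finset.sum_congr rfl fun a _ => ?_
  rw [← pd_const_mul a _ (hQ' a), ← pd_add a (contDiff_matDiv hS a) (contDiff_const.mul (hQ' a))]
  congr 1
  funext y
  rw [h]
  ring

theorem quadPencil_selfAdjoint_iff (hS : ∀ a b, ContDiff ℝ (⊤ : ℕ∞) (S a b))
    (hSsymm : ∀ a b, S a b = S b a)
    (hP : ∀ a, ContDiff ℝ (⊤ : ℕ∞) (P a)) (hQ : ∀ a, ContDiff ℝ (⊤ : ℕ∞) (Q a))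
    (hc₀ : ContDiff ℝ (⊤ : ℕ∞) c₀) (hc₁ : ContDiff ℝ (⊤ : ℕ∞) c₁)
    (hc₂ : ContDiff ℝ (⊤ : ℕ∞) c₂) :
    (∀ lam : ℝ, ∀ f g : (Fin n → ℝ) → ℝ,
        ContDiff ℝ (⊤ : ℕ∞) f → HasCompactSupport f → ContDiff ℝ (⊤ : ℕ∞) g → HasCompactSupport g →
        ∫ x, quadPencil lam S P Q c₀ c₁ c₂ f x * g x
          = ∫ x, f x * quadPencil (1 - lam - δ) S P Q c₀ c₁ c₂ g x)
      ↔ (∀ a x, P a x = matDiv S a x + (δ - 1) * (Q a x / 2)) ∧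
        (∀ x, c₁ x = (∑ a, pd a (fun y => Q a y / 2) x) + (δ - 1) * c₂ x) := by
  have hA : ∀ (lam : ℝ) a, ContDiff ℝ (⊤ : ℕ∞) (fun y => P a y + lam * Q a y) := fun lam a =>
    (hP a).add (contDiff_const.mul (hQ a))
  have hC : ∀ lam : ℝ, ContDiff ℝ (⊤ : ℕ∞) (fun y => c₀ y + lam * c₁ y + lam ^ 2 * c₂ y) :=
    fun lam => (hc₀.add (contDiff_const.mul hc₁)).add (contDiff_const.mul hc₂)
  have hL : ∀ (lam : ℝ) (f g : (Fin n → ℝ) → ℝ),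
      ∫ x, quadPencil lam S P Q c₀ c₁ c₂ f x * g x
        = (1 / 2) * ∫ x, diffOp S (fun a y => P a y + lam * Q a y)
          (fun y => c₀ y + lam * c₁ y + lam ^ 2 * c₂ y) f x * g x := by
    intro lam f g
    simp only [quadPencil_eq_diffOp, mul_assoc]
    exact integral_const_mul _ _
  have hR : ∀ (lam : ℝ) (f g : (Fin n → ℝ) → ℝ),
      ∫ x, f x * quadPencil lam S P Q c₀ c₁ c₂ g x
        = (1 / 2) * ∫ x, f x * diffOp S (fun a y => P a y + lam * Q a y)
          (fun y => c₀ y + lam * c₁ y + lam ^ 2 * c₂ y) g x := by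
    intro lam f g
    simp only [quadPencil_eq_diffOp, mul_left_comm (f _)]
    exact integral_const_mul _ _
  simp only [hL, hR]
  constructor
  · intro h
    have coeff := fun lam : ℝ => diffOp_coeff_eq hS
      (fun a => (contDiff_const.mul (contDiff_matDiv hS a)).sub (hA lam a))
      (((ContDiff.sum fun a _ => contDiff_pd a (contDiff_matDiv hS a)).sub
        (ContDiff.sum fun a _ => contDiff_pd a (hA lam a))).add (hC lam))
      (hA (1 - lam - δ)) (hC (1 - lam - δ))
      (fun f g hf hg => by
        rw [← integral_diffOp_mul hS hSsymm (hA lam) (hC lam) hf hg]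
        linarith [h lam f g hf.1 hf.2 hg.1 hg.2])
    have hPeq : ∀ a x, P a x = matDiv S a x + (δ - 1) * (Q a x / 2) := fun a x => by
      linarith [(coeff 0 x).1 a]
    refine ⟨hPeq, fun x => ?_⟩
    have hx := (coeff (1 - δ / 2) x).2
    simp only [pd_matDiv_add hS hQ hPeq] at hx
    linear_combination hx
  · rintro ⟨hPeq, hc⟩ lam f g hf hf' hg hg'
    rw [integral_diffOp_mul hS hSsymm (hA lam) (hC lam) ⟨hf, hf'⟩ ⟨hg, hg'⟩]
    have e₁ : (fun a y => 2 * matDiv S a y - (P a y + lam * Q a y))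
        = fun a y => P a y + (1 - lam - δ) * Q a y := by
      funext a y
      rw [hPeq]
      ring
    have e₂ : (fun y => ∑ a, pd a (matDiv S a) y - ∑ a, pd a (fun y => P a y + lam * Q a y) y
          + (c₀ y + lam * c₁ y + lam ^ 2 * c₂ y))
        = fun y => c₀ y + (1 - lam - δ) * c₁ y + (1 - lam - δ) ^ 2 * c₂ y := by
      funext y
      rw [pd_matDiv_add hS hQ hPeq, hc]
      ring
    rw [e₁, e₂]

theorem quadPencil_zero_one (x : Fin n → ℝ) :
    quadPencil 0 S P Q c₀ c₁ c₂ (fun _ => (1:ℝ)) x = 0 ↔ c₀ x = 0 := by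
  rw [quadPencil_eq_diffOp, diffOp_one]
  simp

end Pencil

/-- a quadratic pencil is normalized and self-adjoint iff it is
the canonical pencil with `γ^a = Q^a/2` and `θ = c₂`. -/
theorem statement3 (n : ℕ) (δ : ℝ)
    (S : Fin n → Fin n → (Fin n → ℝ) → ℝ) (P Q : Fin n → (Fin n → ℝ) → ℝ)
    (c₀ c₁ c₂ : (Fin n → ℝ) → ℝ)
    (hS : ∀ a b, ContDiff ℝ (⊤ : ℕ∞) (S a b)) (hSsymm : ∀ a b, S a b = S b a)
    (hP : ∀ a, ContDiff ℝ (⊤ : ℕ∞) (P a)) (hQ : ∀ a, ContDiff ℝ (⊤ : ℕ∞) (Q a))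
    (hc₀ : ContDiff ℝ (⊤ : ℕ∞) c₀) (hc₁ : ContDiff ℝ (⊤ : ℕ∞) c₁) (hc₂ : ContDiff ℝ (⊤ : ℕ∞) c₂) :
    -- normalization Δ₀(1) = 0 and self-adjointness ...
    (((∀ x, quadPencil 0 S P Q c₀ c₁ c₂ (fun _ => (1:ℝ)) x = 0) ∧
      (∀ lam : ℝ, ∀ f g : (Fin n → ℝ) → ℝ,
        ContDiff ℝ (⊤ : ℕ∞) f → HasCompactSupport f → ContDiff ℝ (⊤ : ℕ∞) g → HasCompactSupport g →
        ∫ x, quadPencil lam S P Q c₀ c₁ c₂ f x * g x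
          = ∫ x, f x * quadPencil (1 - lam - δ) S P Q c₀ c₁ c₂ g x))
      -- ... hold iff the coefficients are those of the canonical pencil:
      ↔ ((∀ x, c₀ x = 0) ∧
         (∀ a x, P a x = (∑ b, pd b (S b a) x) + (δ - 1) * (Q a x / 2)) ∧
         (∀ x, c₁ x = (∑ a, pd a (fun y => Q a y / 2) x) + (δ - 1) * c₂ x)))
    ∧
    -- and these coefficient conditions say exactly that Δ_λ is the canonical
    -- pencil with γ^a = Q^a/2 and θ = c₂:
    (((∀ x, c₀ x = 0) ∧
      (∀ a x, P a x = (∑ b, pd b (S b a) x) + (δ - 1) * (Q a x / 2)) ∧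
      (∀ x, c₁ x = (∑ a, pd a (fun y => Q a y / 2) x) + (δ - 1) * c₂ x))
      ↔ (∀ lam : ℝ, ∀ f : (Fin n → ℝ) → ℝ, ∀ x,
          quadPencil lam S P Q c₀ c₁ c₂ f x
            = pencil δ lam S (fun a y => Q a y / 2) c₂ f x)) := by
  refine ⟨?_, quadPencil_eq_pencil_iff⟩
  exact and_congr (forall_congr' quadPencil_zero_one)
    (quadPencil_selfAdjoint_iff hS hSsymm hP hQ hc₀ hc₁ hc₂)
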